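/- Let n ≥ 2 be an integer, s ∈ (0,1), and let φ ∈ C_c^∞(ℝ^{n−1}; [0,1]) satisfy φ(x′) = 1 for |x′| ≤ 1/2 and φ(x′) = 0 for |x′| ≥ 3/4. For η > 0 define F := {x ∈ ℝⁿ : x_n < η·φ(x′)} and, for M ≥ 1, define G := F ∪ {x ∈ ℝⁿ : x_n > 4M}. Then there exists c > 0, depending only on n, s and φ, such that whenever η ∈ (0, c·M^{−s}], for every p ∈ ∂F the nonlocal mean curvature H_s(G, p) exists and is strictly negative. -/

import Mathlib

open MeasureTheory Set Filter
open scoped ENNReal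

/-- The last coordinate `x_n` of a point `x = (x', x_n) ∈ ℝⁿ`. -/
noncomputable def lastCoord {n : ℕ} (x : EuclideanSpace ℝ (Fin n)) : ℝ :=
  if h : 0 < n then x ⟨n - 1, by omega⟩ else 0

/-- The projection `x ↦ x'` onto the first `n-1` coordinates. -/
noncomputable def projFirst {n : ℕ} (x : EuclideanSpace ℝ (Fin n)) :
    EuclideanSpace ℝ (Fin (n - 1)) :=
  (EuclideanSpace.equiv (Fin (n - 1)) ℝ).symm fun i => x (Fin.castLE (Nat.sub_le n 1) i)

/-- The truncated nonlocal mean curvature integral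
`∫_{|y−p|>ε} (χ_{Fᶜ}(y) − χ_F(y)) |y−p|^{−(n+s)} dy`. -/
noncomputable def nmcAt (n : ℕ) (s : ℝ) (F : Set (EuclideanSpace ℝ (Fin n)))
    (p : EuclideanSpace ℝ (Fin n)) (ε : ℝ) : ℝ :=
  ∫ y in {y : EuclideanSpace ℝ (Fin n) | ε < ‖y - p‖},
    (Set.indicator Fᶜ (fun _ => (1 : ℝ)) y - Set.indicator F (fun _ => (1 : ℝ)) y) *
      ‖y - p‖ ^ (-((n : ℝ) + s))

/-- The nonlocal mean curvature of `F` at `p` exists (as a principal value as `ε → 0⁺`)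
and equals `h`. -/
def HasNMC (n : ℕ) (s : ℝ) (F : Set (EuclideanSpace ℝ (Fin n)))
    (p : EuclideanSpace ℝ (Fin n)) (h : ℝ) : Prop :=
  Filter.Tendsto (nmcAt n s F p) (nhdsWithin 0 (Set.Ioi 0)) (nhds h)

section Coordinates

variable {n : ℕ}

@[simp]
lemma projFirst_apply (x : EuclideanSpace ℝ (Fin n)) (i : Fin (n - 1)) :
    projFirst x i = x (Fin.castLE (Nat.sub_le n 1) i) := rfl

lemma lastCoord_add (x y : EuclideanSpace ℝ (Fin n)) :
    lastCoord (x + y) = lastCoord x + lastCoord y := by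
  unfold lastCoord
  split_ifs <;> simp

lemma lastCoord_neg (x : EuclideanSpace ℝ (Fin n)) : lastCoord (-x) = -lastCoord x := by
  unfold lastCoord
  split_ifs <;> simp

lemma projFirst_add (x y : EuclideanSpace ℝ (Fin n)) :
    projFirst (x + y) = projFirst x + projFirst y := by
  ext i
  simp

lemma projFirst_neg (x : EuclideanSpace ℝ (Fin n)) : projFirst (-x) = -projFirst x := by
  ext i
  simp

@[fun_prop]
lemma continuous_lastCoord : Continuous (lastCoord : EuclideanSpace ℝ (Fin n) → ℝ) := by
  unfold lastCoord
  split_ifs <;> fun_prop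

@[fun_prop]
lemma continuous_projFirst :
    Continuous (projFirst : EuclideanSpace ℝ (Fin n) → EuclideanSpace ℝ (Fin (n - 1))) := by
  unfold projFirst
  fun_prop

lemma norm_sq_eq_projFirst_add_lastCoord (hn : 0 < n) (x : EuclideanSpace ℝ (Fin n)) :
    ‖x‖ ^ 2 = ‖projFirst x‖ ^ 2 + lastCoord x ^ 2 := by
  obtain ⟨m, rfl⟩ : ∃ m, n = m + 1 := ⟨n - 1, by omega⟩
  rw [EuclideanSpace.norm_sq_eq, EuclideanSpace.norm_sq_eq, Fin.sum_univ_castSucc]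
  simp only [lastCoord, hn, dif_pos, Real.norm_eq_abs, sq_abs]
  rfl

lemma norm_projFirst_le (hn : 0 < n) (x : EuclideanSpace ℝ (Fin n)) : ‖projFirst x‖ ≤ ‖x‖ := by
  refine (sq_le_sq₀ (norm_nonneg _) (norm_nonneg _)).1 ?_
  nlinarith [norm_sq_eq_projFirst_add_lastCoord hn x, sq_nonneg (lastCoord x)]

lemma abs_lastCoord_le_norm (hn : 0 < n) (x : EuclideanSpace ℝ (Fin n)) :
    |lastCoord x| ≤ ‖x‖ := by
  refine abs_le_of_sq_le_sq ?_ (norm_nonneg x)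
  nlinarith [norm_sq_eq_projFirst_add_lastCoord hn x, sq_nonneg ‖projFirst x‖]

/-- The splitting `x = (x', x_n)` carries Lebesgue measure to the product measure. -/
lemma measurePreserving_projFirst_lastCoord (hn : 0 < n) :
    MeasurePreserving
      (fun x : EuclideanSpace ℝ (Fin n) => (projFirst x, lastCoord x)) := by
  obtain ⟨m, rfl⟩ : ∃ m, n = m + 1 := ⟨n - 1, by omega⟩
  have h₁ := PiLp.volume_preserving_ofLp (Fin (m + 1))
  have h₂ := volume_preserving_piFinSuccAbove (fun _ : Fin (m + 1) => ℝ) (Fin.last m)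
  have h₃ : MeasurePreserving (Prod.swap : ℝ × (Fin m → ℝ) → (Fin m → ℝ) × ℝ) :=
    Measure.measurePreserving_swap
  have h₄ := (PiLp.volume_preserving_toLp (Fin m)).prod
    (MeasurePreserving.id (volume : Measure ℝ))
  have h₅ := h₄.comp (h₃.comp (h₂.comp h₁))
  have heq : (fun x : EuclideanSpace ℝ (Fin (m + 1)) => (projFirst x, lastCoord x)) =
      Prod.map (WithLp.toLp 2) id ∘ Prod.swap ∘
        MeasurableEquiv.piFinSuccAbove (fun _ : Fin (m + 1) => ℝ) (Fin.last m) ∘ WithLp.ofLp := by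
    funext x
    refine Prod.ext ?_ rfl
    ext i
    exact congrArg x.ofLp (Fin.succAbove_last_apply i).symm
  rw [heq]
  exact h₅

end Coordinates

section Calculus

variable {E : Type*} [NormedAddCommGroup E] [NormedSpace ℝ E]

/-- The first-order Taylor remainder of a compactly supported `C²` function is globally
controlled by both the quadratic and the linear term. -/
lemma exists_taylor_remainder_le {f : E → ℝ} (hf : ContDiff ℝ 2 f) (hc : HasCompactSupport f) :
    ∃ K : ℝ, 0 ≤ K ∧ ∀ x z : E,
      |f (x + z) - f x - fderiv ℝ f x z| ≤ K * (‖z‖ * min ‖z‖ 1) := by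
  obtain ⟨A, hA⟩ := hf.lipschitzWith_of_hasCompactSupport hc (by norm_num)
  have hf' : ContDiff ℝ 1 (fderiv ℝ f) := hf.fderiv_right (by norm_num)
  obtain ⟨B, hB⟩ := hf'.lipschitzWith_of_hasCompactSupport (hc.fderiv ℝ) (by norm_num)
  refine ⟨max B (2 * A), by positivity, fun x z => ?_⟩
  have hlin : |f (x + z) - f x - fderiv ℝ f x z| ≤ 2 * A * ‖z‖ := by
    have h₁ : |f (x + z) - f x| ≤ A * ‖z‖ := by
      simpa [Real.norm_eq_abs] using hA.norm_sub_le (x + z) x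
    have h₂ : |fderiv ℝ f x z| ≤ A * ‖z‖ :=
      ((fderiv ℝ f x).le_opNorm z).trans
        (mul_le_mul_of_nonneg_right (norm_fderiv_le_of_lipschitz ℝ hA) (norm_nonneg z))
    calc _ ≤ |f (x + z) - f x| + |fderiv ℝ f x z| := abs_sub _ _
      _ ≤ _ := by linarith
  have hquad : |f (x + z) - f x - fderiv ℝ f x z| ≤ B * ‖z‖ * ‖z‖ := by
    have h := (convex_closedBall x ‖z‖).norm_image_sub_le_of_norm_hasFDerivWithin_le'
      (f := f) (f' := fderiv ℝ f) (φ := fderiv ℝ f x) (C := B * ‖z‖) (x := x) (y := x + z)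
      (fun y _ => (hf.differentiable (by norm_num) y).hasFDerivAt.hasFDerivWithinAt)
      (fun y hy => (hB.norm_sub_le y x).trans (by
        have := mem_closedBall_iff_norm.1 hy
        gcongr)) (by simp) (by simp)
    simpa [Real.norm_eq_abs] using h
  rcases le_total ‖z‖ 1 with h | h
  · rw [min_eq_left h, ← mul_assoc]
    exact hquad.trans (by gcongr; exact le_max_left _ _)
  · rw [min_eq_right h, mul_one]
    exact hlin.trans (by gcongr; exact le_max_right _ _)

end Calculus

section Kernel

variable {E : Type*} [NormedAddCommGroup E] [NormedSpace ℝ E] [FiniteDimensional ℝ E]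
  [MeasurableSpace E] [BorelSpace E] (μ : Measure E) [μ.IsAddHaarMeasure]

lemma integrableOn_norm_rpow_neg_of_lt_norm {r ε : ℝ} (hr : (Module.finrank ℝ E : ℝ) < r)
    (hε : 0 < ε) : IntegrableOn (fun z : E => ‖z‖ ^ (-r)) {z | ε < ‖z‖} μ := by
  have hr0 : 0 < r := lt_of_le_of_lt (Nat.cast_nonneg _) hr
  have hS : MeasurableSet {z : E | ε < ‖z‖} :=
    (isOpen_lt continuous_const continuous_norm).measurableSet
  refine Integrable.mono' (((integrable_one_add_norm (μ := μ) hr).const_mul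
    ((ε / (1 + ε)) ^ (-r))).integrableOn)
    (measurable_norm.pow_const _).aestronglyMeasurable ?_
  filter_upwards [ae_restrict_mem hS] with z hz
  have hz : ε < ‖z‖ := hz
  rw [Real.norm_of_nonneg (by positivity), ← Real.mul_rpow (by positivity) (by positivity)]
  refine Real.rpow_le_rpow_of_nonpos (by positivity) ?_ (by linarith)
  rw [div_mul_eq_mul_div, div_le_iff₀ (by positivity)]
  nlinarith

lemma integrable_norm_mul_min_mul_rpow_neg [Nontrivial E] {s : ℝ} (hs : s ∈ Ioo (0 : ℝ) 1) :
    Integrable (fun z : E =>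
      ‖z‖ * min ‖z‖ 1 * ‖z‖ ^ (-((Module.finrank ℝ E : ℝ) + 1 + s))) μ := by
  set d := Module.finrank ℝ E with hd
  have hd0 : 1 ≤ d := Module.finrank_pos
  rw [integrable_fun_norm_addHaar μ
    (f := fun y : ℝ => y * min y 1 * y ^ (-((d : ℝ) + 1 + s)))]
  have key : ∀ y : ℝ, 0 < y → y ^ (d - 1) • (y * min y 1 * y ^ (-((d : ℝ) + 1 + s))) =
      min y 1 * y ^ (-1 - s) := fun y hy => by
    have : y ^ (-1 - s) = y ^ (d - 1) * y * y ^ (-((d : ℝ) + 1 + s)) := by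
      rw [← pow_succ, Nat.sub_add_cancel hd0, ← Real.rpow_natCast, ← Real.rpow_add hy]
      congr 1
      ring
    rw [this, smul_eq_mul]
    ring
  rw [← Ioc_union_Ioi_eq_Ioi zero_le_one]
  refine IntegrableOn.union ?_ ?_
  · have h := (intervalIntegral.intervalIntegrable_rpow' (a := 0) (b := 1)
      (r := -s) (by linarith [hs.2])).1
    refine h.congr_fun (fun y hy => ?_) measurableSet_Ioc
    change _ = y ^ (d - 1) • (y * min y 1 * y ^ (-((d : ℝ) + 1 + s)))
    rw [key y hy.1, min_eq_left hy.2, ← Real.rpow_one_add' hy.1.le (by linarith [hs.1])]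
    ring_nf
  · refine (integrableOn_Ioi_rpow_of_lt (a := -1 - s) (by linarith [hs.1]) one_pos).congr_fun
      (fun y hy => ?_) measurableSet_Ioi
    have hy : 1 < y := hy
    change _ = y ^ (d - 1) • (y * min y 1 * y ^ (-((d : ℝ) + 1 + s)))
    rw [key y (by linarith), min_eq_right hy.le, one_mul]

/-- A set containing a ball of radius `M` at distance `6 M` from the origin carries kernel mass
at least of order `M ^ (-s)`. -/
lemma ball_mass_mul_rpow_le_setIntegral [Nontrivial E] {s M : ℝ} (hs : 0 < s) (hM : 0 < M)
    {A : Set E} {x : E} (hx : ‖x‖ = 6 * M) (hA : Metric.ball x M ⊆ A)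
    (hint : IntegrableOn (fun z : E => ‖z‖ ^ (-((Module.finrank ℝ E : ℝ) + s))) A μ) :
    7 ^ (-((Module.finrank ℝ E : ℝ) + s)) * μ.real (Metric.ball 0 1) * M ^ (-s) ≤
      ∫ z in A, ‖z‖ ^ (-((Module.finrank ℝ E : ℝ) + s)) ∂μ := by
  set d := Module.finrank ℝ E with hd
  have hball : μ.real (Metric.ball x M) = M ^ d * μ.real (Metric.ball 0 1) := by
    rw [measureReal_def, Measure.addHaar_ball μ x hM.le, ENNReal.toReal_mul,
      ENNReal.toReal_ofReal (by positivity), measureReal_def]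
  have hpow : (7 * M) ^ (-((d : ℝ) + s)) * M ^ d = 7 ^ (-((d : ℝ) + s)) * M ^ (-s) := by
    rw [Real.mul_rpow (by norm_num) hM.le, mul_assoc, ← Real.rpow_natCast, ← Real.rpow_add hM]
    congr 2
    ring
  calc 7 ^ (-((d : ℝ) + s)) * μ.real (Metric.ball 0 1) * M ^ (-s)
      = ∫ _ in Metric.ball x M, (7 * M) ^ (-((d : ℝ) + s)) ∂μ := by
        rw [setIntegral_const, hball, smul_eq_mul]
        linear_combination (-μ.real (Metric.ball (0 : E) 1)) * hpow
    _ ≤ ∫ z in Metric.ball x M, ‖z‖ ^ (-((d : ℝ) + s)) ∂μ := by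
        refine setIntegral_mono_on (integrableOn_const measure_ball_lt_top.ne)
          (hint.mono_set hA) measurableSet_ball fun z hz => ?_
        have hz := mem_ball_iff_norm.1 hz
        have h₁ := norm_sub_norm_le z x
        have h₂ := norm_sub_norm_le x z
        rw [norm_sub_rev] at h₂
        exact Real.rpow_le_rpow_of_nonpos (by linarith) (by linarith)
          (by linarith [(Nat.cast_nonneg d : (0 : ℝ) ≤ d)])
    _ ≤ _ := setIntegral_mono_set hint (Eventually.of_forall fun z => by positivity)
        (Eventually.of_forall hA)

end Kernel

section Layer

variable {n : ℕ}

/-- The mass of the singular kernel in the layer around the graph of a linear function whose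
thickness is quadratic near the origin and linear away from it. -/
lemma integrableOn_layer_and_setIntegral_le (hn : 2 ≤ n) {s : ℝ} (hs : s ∈ Ioo (0 : ℝ) 1)
    (L : EuclideanSpace ℝ (Fin (n - 1)) →L[ℝ] ℝ) {B : ℝ} (hB : 0 ≤ B) :
    IntegrableOn (fun z : EuclideanSpace ℝ (Fin n) => ‖z‖ ^ (-((n : ℝ) + s)))
        {z | |lastCoord z - L (projFirst z)| ≤ B * (‖projFirst z‖ * min ‖projFirst z‖ 1)} ∧
      ∫ z in {z : EuclideanSpace ℝ (Fin n) |
          |lastCoord z - L (projFirst z)| ≤ B * (‖projFirst z‖ * min ‖projFirst z‖ 1)},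
        ‖z‖ ^ (-((n : ℝ) + s)) ≤
        2 * B * ∫ x : EuclideanSpace ℝ (Fin (n - 1)),
          ‖x‖ * min ‖x‖ 1 * ‖x‖ ^ (-((n : ℝ) + s)) := by
  have hn0 : 0 < n := by omega
  have : Nonempty (Fin (n - 1)) := ⟨⟨0, by omega⟩⟩
  set r : ℝ := (n : ℝ) + s with hr
  have hr0 : 0 < r := by have := hs.1; positivity
  set R : Set (EuclideanSpace ℝ (Fin n)) :=
    {z | |lastCoord z - L (projFirst z)| ≤ B * (‖projFirst z‖ * min ‖projFirst z‖ 1)} with hR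
  set q : EuclideanSpace ℝ (Fin (n - 1)) → ℝ := fun x => ‖x‖ * min ‖x‖ 1 * ‖x‖ ^ (-r) with hq
  have hq0 : ∀ x, 0 ≤ q x := fun x => by positivity
  have hqint : Integrable q := by
    have h := integrable_norm_mul_min_mul_rpow_neg
      (volume : Measure (EuclideanSpace ℝ (Fin (n - 1)))) hs
    rw [finrank_euclideanSpace_fin] at h
    have hcast : ((n - 1 : ℕ) : ℝ) + 1 = n := by
      rw [Nat.cast_sub (by omega)]
      simp
    rwa [hcast] at h
  have hRmeas : MeasurableSet R := by
    refine (isClosed_le ?_ ?_).measurableSet <;> fun_prop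
  let P : Set (EuclideanSpace ℝ (Fin (n - 1)) × ℝ) :=
    {y | |y.2 - L y.1| ≤ B * (‖y.1‖ * min ‖y.1‖ 1)}
  have hPmeas : MeasurableSet P := by
    refine (isClosed_le ?_ ?_).measurableSet <;> fun_prop
  let f : EuclideanSpace ℝ (Fin (n - 1)) × ℝ → ℝ≥0∞ :=
    P.indicator fun y => ENNReal.ofReal (‖y.1‖ ^ (-r))
  have hf : Measurable f :=
    ((measurable_fst.norm.pow_const _).ennreal_ofReal).indicator hPmeas
  have hpoint : ∀ z, R.indicator (fun z => ENNReal.ofReal (‖z‖ ^ (-r))) z ≤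
      f (projFirst z, lastCoord z) := fun z => by
    by_cases hz : z ∈ R
    · have hzP : (projFirst z, lastCoord z) ∈ P := hz
      simp only [f, indicator_of_mem hz, indicator_of_mem hzP]
      refine ENNReal.ofReal_le_ofReal ?_
      rcases (norm_nonneg (projFirst z)).eq_or_lt with h0 | h0
      · have hp : projFirst z = 0 := norm_eq_zero.1 h0.symm
        have hl : lastCoord z = 0 := by simpa [hR, hp] using hz
        have hz0 : ‖z‖ = 0 := by
          simpa [hp, hl] using norm_sq_eq_projFirst_add_lastCoord hn0 z
        rw [hz0, ← h0]
      · exact Real.rpow_le_rpow_of_nonpos h0 (norm_projFirst_le hn0 z) (by linarith)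
    · simp [indicator_of_notMem hz]
  have hinner : ∀ x, ∫⁻ t, f (x, t) = ENNReal.ofReal (2 * B * q x) := fun x => by
    have h : (fun t => f (x, t)) = (Metric.closedBall (L x) (B * (‖x‖ * min ‖x‖ 1))).indicator
        fun _ => ENNReal.ofReal (‖x‖ ^ (-r)) := by
      funext t
      simp only [f, indicator, P, mem_ofPred_eq, Metric.mem_closedBall, Real.dist_eq]
    rw [h, lintegral_indicator_const Metric.isClosed_closedBall.measurableSet,
      Real.volume_closedBall, ← ENNReal.ofReal_mul (by positivity)]
    congr 1
    simp only [hq]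
    ring
  have hbound : ∫⁻ z in R, ENNReal.ofReal (‖z‖ ^ (-r)) ≤
      ENNReal.ofReal (2 * B * ∫ x, q x) := by
    calc ∫⁻ z in R, ENNReal.ofReal (‖z‖ ^ (-r))
        = ∫⁻ z, R.indicator (fun z => ENNReal.ofReal (‖z‖ ^ (-r))) z :=
          (lintegral_indicator hRmeas _).symm
      _ ≤ ∫⁻ z : EuclideanSpace ℝ (Fin n), f (projFirst z, lastCoord z) :=
          lintegral_mono hpoint
      _ = ∫⁻ x, ∫⁻ t, f (x, t) := by
          rw [(measurePreserving_projFirst_lastCoord hn0).lintegral_comp hf,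
            Measure.volume_eq_prod, lintegral_prod _ hf.aemeasurable]
      _ = ∫⁻ x, ENNReal.ofReal (2 * B * q x) := lintegral_congr hinner
      _ = ENNReal.ofReal (2 * B * ∫ x, q x) := by
          rw [← integral_const_mul, ofReal_integral_eq_lintegral_ofReal (hqint.const_mul _)
            (Eventually.of_forall fun x => mul_nonneg (by positivity) (hq0 x))]
  have hsm : AEStronglyMeasurable (fun z : EuclideanSpace ℝ (Fin n) => ‖z‖ ^ (-r))
      (volume.restrict R) := (measurable_norm.pow_const _).aestronglyMeasurable
  have hnn : 0 ≤ᵐ[volume.restrict R] fun z : EuclideanSpace ℝ (Fin n) => ‖z‖ ^ (-r) :=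
    Eventually.of_forall fun z => by positivity
  refine ⟨⟨hsm, ?_⟩, ?_⟩
  · rw [hasFiniteIntegral_iff_ofReal hnn]
    exact hbound.trans_lt ENNReal.ofReal_lt_top
  · rw [integral_eq_lintegral_of_nonneg_ae hnn hsm]
    exact ENNReal.toReal_le_of_le_ofReal
      (mul_nonneg (by positivity) (integral_nonneg hq0)) hbound

end Layer

section PrincipalValue

variable {n : ℕ}

lemma measurable_real_sign : Measurable Real.sign := by
  unfold Real.sign
  exact Measurable.ite measurableSet_Iio measurable_const
    (Measurable.ite measurableSet_Ioi measurable_const measurable_const)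

/-- The sign `±1` with which the point `p + z` enters the nonlocal mean curvature of `F`. -/
noncomputable def nmcSign (F : Set (EuclideanSpace ℝ (Fin n))) (p z : EuclideanSpace ℝ (Fin n)) :
    ℝ :=
  open Classical in if p + z ∈ F then -1 else 1

lemma measurable_nmcSign {F : Set (EuclideanSpace ℝ (Fin n))} (hF : MeasurableSet F)
    (p : EuclideanSpace ℝ (Fin n)) : Measurable (nmcSign F p) :=
  Measurable.ite (measurable_const_add p hF) measurable_const measurable_const

lemma nmcAt_eq_setIntegral_nmcSign (s : ℝ) (F : Set (EuclideanSpace ℝ (Fin n)))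
    (p : EuclideanSpace ℝ (Fin n)) (ε : ℝ) :
    nmcAt n s F p ε = ∫ z in {z | ε < ‖z‖}, nmcSign F p z * ‖z‖ ^ (-((n : ℝ) + s)) := by
  have hS : MeasurableSet {z : EuclideanSpace ℝ (Fin n) | ε < ‖z‖} :=
    (isOpen_lt continuous_const continuous_norm).measurableSet
  have hS' : MeasurableSet {z : EuclideanSpace ℝ (Fin n) | ε < ‖z - p‖} :=
    (isOpen_lt continuous_const (by fun_prop)).measurableSet
  rw [nmcAt, ← integral_indicator hS, ← integral_indicator hS',
    ← integral_sub_right_eq_self ({z | ε < ‖z‖}.indicator fun z =>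
      nmcSign F p z * ‖z‖ ^ (-((n : ℝ) + s))) p]
  refine integral_congr_ae (Eventually.of_forall fun y => ?_)
  by_cases hy : y ∈ F <;> simp [indicator, nmcSign, hy]

lemma setIntegral_lt_norm_eq_zero_of_odd {f : EuclideanSpace ℝ (Fin n) → ℝ}
    (hf : ∀ z, f (-z) = -f z) (ε : ℝ) : ∫ z in {z | ε < ‖z‖}, f z = 0 := by
  have hS : MeasurableSet {z : EuclideanSpace ℝ (Fin n) | ε < ‖z‖} :=
    (isOpen_lt continuous_const continuous_norm).measurableSet
  rw [← integral_indicator hS]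
  have h := integral_neg_eq_self ({z : EuclideanSpace ℝ (Fin n) | ε < ‖z‖}.indicator f) volume
  have h' : ∀ z, {z : EuclideanSpace ℝ (Fin n) | ε < ‖z‖}.indicator f (-z) =
      -{z : EuclideanSpace ℝ (Fin n) | ε < ‖z‖}.indicator f z := fun z => by
    by_cases hz : ε < ‖z‖ <;> simp [indicator, hz, hf]
  simp only [h', integral_neg] at h
  linarith

/-- If the kernel is integrable against the difference between the sign of `F` and the sign of
an odd function, then the principal value exists and equals the corresponding integral. -/
lemma hasNMC_of_integrable_sub_sign {s : ℝ} (hs : 0 < s) (F : Set (EuclideanSpace ℝ (Fin n)))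
    (p : EuclideanSpace ℝ (Fin n)) {v : EuclideanSpace ℝ (Fin n) → ℝ}
    (hv : Measurable v) (hodd : ∀ z, v (-z) = -v z)
    (hint : Integrable fun z =>
      (nmcSign F p z - Real.sign (v z)) * ‖z‖ ^ (-((n : ℝ) + s))) :
    HasNMC n s F p
      (∫ z, (nmcSign F p z - Real.sign (v z)) * ‖z‖ ^ (-((n : ℝ) + s))) := by
  set r : ℝ := (n : ℝ) + s with hr
  have hr0 : 0 < r := by positivity
  set D : EuclideanSpace ℝ (Fin n) → ℝ :=
    fun z => (nmcSign F p z - Real.sign (v z)) * ‖z‖ ^ (-r) with hD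
  have hS : ∀ ε : ℝ, MeasurableSet {z : EuclideanSpace ℝ (Fin n) | ε < ‖z‖} := fun ε =>
    (isOpen_lt continuous_const continuous_norm).measurableSet
  have hlim : Tendsto (fun ε : ℝ => ∫ z, {z : EuclideanSpace ℝ (Fin n) | ε < ‖z‖}.indicator D z)
      (nhdsWithin 0 (Ioi 0)) (nhds (∫ z, D z)) := by
    refine tendsto_integral_filter_of_dominated_convergence (fun z => ‖D z‖)
      (Eventually.of_forall fun ε => hint.aestronglyMeasurable.indicator (hS ε))
      (Eventually.of_forall fun ε => Eventually.of_forall fun z => norm_indicator_le_norm_self _ _)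
      hint.norm (Eventually.of_forall fun z => ?_)
    rcases eq_or_ne z 0 with rfl | hz
    · have h0 : D 0 = 0 := by simp [hD, Real.zero_rpow (neg_ne_zero.2 hr0.ne')]
      simp [indicator, h0]
    · refine tendsto_const_nhds.congr' ?_
      filter_upwards [nhdsWithin_le_nhds (Iio_mem_nhds (norm_pos_iff.2 hz))] with ε hε
      exact (indicator_of_mem (show z ∈ {z | ε < ‖z‖} from hε) D).symm
  refine hlim.congr' ?_
  filter_upwards [self_mem_nhdsWithin] with ε hε
  have hw : IntegrableOn (fun z : EuclideanSpace ℝ (Fin n) => ‖z‖ ^ (-r)) {z | ε < ‖z‖} :=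
    integrableOn_norm_rpow_neg_of_lt_norm volume (by simp [hr, hs]) hε
  have hsgn : IntegrableOn (fun z => Real.sign (v z) * ‖z‖ ^ (-r)) {z | ε < ‖z‖} := by
    refine hw.bdd_mul (c := 1) (measurable_real_sign.comp hv).aestronglyMeasurable
      (Eventually.of_forall fun z => ?_)
    rcases Real.sign_apply_eq (v z) with h | h | h <;> simp [h]
  have hodd' := setIntegral_lt_norm_eq_zero_of_odd
    (f := fun z => Real.sign (v z) * ‖z‖ ^ (-r)) (fun z => by simp [hodd, Real.sign_neg]) ε
  rw [integral_indicator (hS ε), nmcAt_eq_setIntegral_nmcSign, ← add_zero (∫ z in _, D z),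
    ← hodd', ← integral_add hint.integrableOn hsgn]
  refine integral_congr_ae (Eventually.of_forall fun z => ?_)
  simp only [hD]
  ring

end PrincipalValue

section Barrier

variable {n : ℕ}

lemma exists_norm_eq_and_ball_subset_lt_lastCoord (hn : 0 < n) {M : ℝ} (hM : 0 < M) :
    ∃ x : EuclideanSpace ℝ (Fin n), ‖x‖ = 6 * M ∧
      Metric.ball x M ⊆ {z | 4 * M < lastCoord z} := by
  refine ⟨EuclideanSpace.single ⟨n - 1, by omega⟩ (6 * M), ?_, fun z hz => ?_⟩
  · simp [abs_of_pos hM]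
  · set x : EuclideanSpace ℝ (Fin n) := EuclideanSpace.single ⟨n - 1, by omega⟩ (6 * M)
    have hx : lastCoord x = 6 * M := by simp [lastCoord, hn, x]
    have h := (abs_lastCoord_le_norm hn (z - x)).trans_lt (mem_ball_iff_norm.1 hz)
    rw [sub_eq_add_neg, lastCoord_add, lastCoord_neg, hx] at h
    have := (abs_lt.1 h).1
    change 4 * M < lastCoord z
    linarith

/-- Away from the layer where the graph deviates from its tangent plane, the sign of the
subgraph is that of the tangent half-space. -/
lemma abs_ite_sub_sign_le {v e b : ℝ} (he : |e| ≤ b) :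
    |(if v < e then (-1 : ℝ) else 1) - Real.sign v| ≤ if |v| ≤ b then 2 else 0 := by
  have he' := abs_le.1 he
  split_ifs with h₁ h₂ h₂
  · rcases Real.sign_apply_eq v with h | h | h <;> rw [h] <;> norm_num
  · rw [Real.sign_of_neg]
    · norm_num
    · by_contra hv
      exact h₂ (by rw [abs_of_nonneg (not_lt.1 hv)]; linarith)
  · rcases Real.sign_apply_eq v with h | h | h <;> rw [h] <;> norm_num
  · rw [Real.sign_of_pos]
    · norm_num
    · by_contra hv
      exact h₂ (by rw [abs_of_nonpos (not_lt.1 hv)]; linarith)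

/-- For a subgraph `{x_n < u(x')}` whose Taylor remainder at `p'` is at most `B |z'| min(|z'|, 1)`,
completed by the half-space `{x_n > H}` above it, the nonlocal mean curvature at the graph point
`p` exists, and it exceeds minus twice the mass of the half-space by at most a multiple of `B`. -/
lemma exists_hasNMC_le (hn : 2 ≤ n) {s : ℝ} (hs : s ∈ Ioo (0 : ℝ) 1)
    {u : EuclideanSpace ℝ (Fin (n - 1)) → ℝ} (hu : Continuous u) {H : ℝ} (huH : ∀ x, u x ≤ H)
    {p : EuclideanSpace ℝ (Fin n)} (hp : lastCoord p = u (projFirst p)) (hpH : lastCoord p < H)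
    (L : EuclideanSpace ℝ (Fin (n - 1)) →L[ℝ] ℝ) {B : ℝ} (hB : 0 ≤ B)
    (hL : ∀ z, |u (projFirst p + z) - u (projFirst p) - L z| ≤ B * (‖z‖ * min ‖z‖ 1)) :
    IntegrableOn (fun z : EuclideanSpace ℝ (Fin n) => ‖z‖ ^ (-((n : ℝ) + s)))
        {z | H < lastCoord (p + z)} ∧
      ∃ h : ℝ, HasNMC n s ({x : EuclideanSpace ℝ (Fin n) | lastCoord x < u (projFirst x)} ∪
          {x : EuclideanSpace ℝ (Fin n) | H < lastCoord x}) p h ∧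
        h ≤ 4 * B * (∫ x : EuclideanSpace ℝ (Fin (n - 1)),
            ‖x‖ * min ‖x‖ 1 * ‖x‖ ^ (-((n : ℝ) + s))) -
          2 * ∫ z in {z : EuclideanSpace ℝ (Fin n) | H < lastCoord (p + z)},
            ‖z‖ ^ (-((n : ℝ) + s)) := by
  classical
  have hn0 : 0 < n := by omega
  obtain ⟨hRint, hRle⟩ := integrableOn_layer_and_setIntegral_le hn hs L hB
  set w : EuclideanSpace ℝ (Fin n) → ℝ := fun z => ‖z‖ ^ (-((n : ℝ) + s)) with hw
  have hw0 : ∀ z, 0 ≤ w z := fun z => by positivity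
  set R : Set (EuclideanSpace ℝ (Fin n)) :=
    {z | |lastCoord z - L (projFirst z)| ≤ B * (‖projFirst z‖ * min ‖projFirst z‖ 1)} with hR
  set A : Set (EuclideanSpace ℝ (Fin n)) := {z | H < lastCoord (p + z)} with hA
  set G : Set (EuclideanSpace ℝ (Fin n)) :=
    {x | lastCoord x < u (projFirst x)} ∪ {x | H < lastCoord x} with hG
  have hRmeas : MeasurableSet R := by
    refine (isClosed_le ?_ ?_).measurableSet <;> fun_prop
  have hAmeas : MeasurableSet A := by
    refine (isOpen_lt ?_ ?_).measurableSet <;> fun_prop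
  have hGmeas : MeasurableSet G := by
    refine ((isOpen_lt ?_ ?_).union (isOpen_lt ?_ ?_)).measurableSet <;> fun_prop
  have hAint : IntegrableOn w A := by
    refine (integrableOn_norm_rpow_neg_of_lt_norm volume (ε := H - lastCoord p)
      (by simp [hs.1]) (sub_pos.2 hpH)).mono_set fun z hz => ?_
    have hz : H < lastCoord (p + z) := hz
    rw [lastCoord_add] at hz
    change H - lastCoord p < ‖z‖
    linarith [(le_abs_self _).trans (abs_lastCoord_le_norm hn0 z)]
  refine ⟨hAint, ?_⟩
  let v : EuclideanSpace ℝ (Fin n) → ℝ := fun z => lastCoord z - L (projFirst z)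
  have hv : Continuous v := by fun_prop
  have hodd : ∀ z, v (-z) = -v z := fun z => by
    simp only [v, lastCoord_neg, projFirst_neg, map_neg]
    ring
  have hsub : ∀ z, |nmcSign G p z - Real.sign (v z) + A.indicator (fun _ => (2 : ℝ)) z| ≤
      R.indicator (fun _ => (2 : ℝ)) z := fun z => by
    have he := abs_ite_sub_sign_le (v := v z) (hL (projFirst z))
    have hiff : v z < u (projFirst p + projFirst z) - u (projFirst p) - L (projFirst z) ↔
        lastCoord (p + z) < u (projFirst (p + z)) := by
      rw [lastCoord_add, projFirst_add, hp]
      constructor <;> intro h <;> simp only [v] at * <;> linarith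
    rw [if_congr hiff rfl rfl] at he
    have hsign : nmcSign G p z + A.indicator (fun _ => (2 : ℝ)) z =
        if lastCoord (p + z) < u (projFirst (p + z)) then -1 else 1 := by
      have hH := huH (projFirst (p + z))
      by_cases h₁ : lastCoord (p + z) < u (projFirst (p + z))
      · have h₂ : ¬ H < lastCoord (p + z) := by linarith
        simp [nmcSign, hG, hA, h₁, h₂]
      · by_cases h₂ : H < lastCoord (p + z)
        · simp [nmcSign, hG, hA, h₁, h₂]
          norm_num
        · simp [nmcSign, hG, hA, h₁, h₂]
    rw [sub_add_eq_add_sub, hsign]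
    exact he
  have hRw : Integrable (R.indicator fun z => 2 * w z) :=
    (integrable_indicator_iff hRmeas).2 (hRint.const_mul 2)
  have hAw : Integrable (A.indicator fun z => 2 * w z) :=
    (integrable_indicator_iff hAmeas).2 (hAint.const_mul 2)
  have hAmul : ∀ z, A.indicator (fun z => 2 * w z) z = A.indicator (fun _ => (2 : ℝ)) z * w z :=
    fun z => by by_cases hz : z ∈ A <;> simp [hz]
  have hRmul : ∀ z, R.indicator (fun z => 2 * w z) z = R.indicator (fun _ => (2 : ℝ)) z * w z :=
    fun z => by by_cases hz : z ∈ R <;> simp [hz]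
  have hDsum : Integrable fun z => (nmcSign G p z - Real.sign (v z)) * w z +
      A.indicator (fun z => 2 * w z) z := by
    refine hRw.mono' (Measurable.aestronglyMeasurable ?_) (Eventually.of_forall fun z => ?_)
    · have hwm : Measurable w := measurable_norm.pow_const _
      exact (((measurable_nmcSign hGmeas p).sub (measurable_real_sign.comp hv.measurable)).mul
        hwm).add ((hwm.const_mul 2).indicator hAmeas)
    · rw [hAmul, hRmul, ← add_mul, norm_mul, Real.norm_eq_abs, Real.norm_of_nonneg (hw0 z)]
      exact mul_le_mul_of_nonneg_right (hsub z) (hw0 z)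
  have hD : Integrable fun z => (nmcSign G p z - Real.sign (v z)) * w z := by
    refine (hDsum.sub hAw).congr (Eventually.of_forall fun z => ?_)
    exact add_sub_cancel_right _ _
  refine ⟨_, hasNMC_of_integrable_sub_sign hs.1 G p hv.measurable hodd hD, ?_⟩
  have hle : ∫ z, (nmcSign G p z - Real.sign (v z)) * w z ≤
      ∫ z, (R.indicator (fun z => 2 * w z) z - A.indicator (fun z => 2 * w z) z) := by
    refine integral_mono hD (hRw.sub hAw) fun z => ?_
    have h := mul_le_mul_of_nonneg_right ((le_abs_self _).trans (hsub z)) (hw0 z)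
    rw [add_mul, ← hAmul, ← hRmul] at h
    change (nmcSign G p z - Real.sign (v z)) * w z ≤ _
    linarith
  rw [integral_sub hRw hAw, integral_indicator hRmeas, integral_indicator hAmeas,
    integral_const_mul, integral_const_mul] at hle
  linarith

end Barrier

/-- **The barrier `G = F ∪ {x_n > 4M}` has strictly negative nonlocal mean curvature
along `∂F`.**
Let `φ ∈ C_c^∞(ℝ^{n−1};[0,1])` with `φ = 1` on `{|x'| ≤ 1/2}` and `φ = 0` on `{|x'| ≥ 3/4}`,
`F = {x_n < η φ(x')}` and `G = F ∪ {x_n > 4M}`. Then there is `c > 0`, depending only on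
`n`, `s` and `φ`, such that whenever `M ≥ 1` and `η ∈ (0, c·M^{−s}]`, for every `p ∈ ∂F` the
nonlocal mean curvature `H_s(G,p)` exists and is strictly negative. -/
theorem barrier_nmc_strictly_negative
    (n : ℕ) (hn : 2 ≤ n) (s : ℝ) (hs : s ∈ Set.Ioo (0 : ℝ) 1)
    (φ : EuclideanSpace ℝ (Fin (n - 1)) → ℝ)
    (hφ_smooth : ContDiff ℝ (⊤ : ℕ∞) φ) (hφ_supp : HasCompactSupport φ)
    (hφ_range : ∀ x', φ x' ∈ Set.Icc (0 : ℝ) 1)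
    (hφ_one : ∀ x', ‖x'‖ ≤ 1 / 2 → φ x' = 1)
    (hφ_zero : ∀ x', 3 / 4 ≤ ‖x'‖ → φ x' = 0) :
    ∃ c : ℝ, 0 < c ∧ ∀ M : ℝ, 1 ≤ M → ∀ η : ℝ, 0 < η → η ≤ c * M ^ (-s) →
      ∀ p ∈ frontier {x : EuclideanSpace ℝ (Fin n) | lastCoord x < η * φ (projFirst x)},
        ∃ h : ℝ,
          HasNMC n s ({x : EuclideanSpace ℝ (Fin n) | lastCoord x < η * φ (projFirst x)} ∪
            {x : EuclideanSpace ℝ (Fin n) | 4 * M < lastCoord x}) p h ∧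
          h < 0 := by
  have hn0 : 0 < n := by omega
  have : Nonempty (Fin n) := ⟨⟨0, hn0⟩⟩
  obtain ⟨K, hK0, hK⟩ :=
    exists_taylor_remainder_le (mod_cast contDiff_infty.1 hφ_smooth 2) hφ_supp
  set J : ℝ := ∫ x : EuclideanSpace ℝ (Fin (n - 1)),
    ‖x‖ * min ‖x‖ 1 * ‖x‖ ^ (-((n : ℝ) + s)) with hJ
  have hJ0 : 0 ≤ J := integral_nonneg fun x => by positivity
  set c₀ : ℝ := 7 ^ (-((n : ℝ) + s)) *
    (volume : Measure (EuclideanSpace ℝ (Fin n))).real (Metric.ball 0 1) with hc₀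
  have hc₀pos : 0 < c₀ := mul_pos (by positivity)
    (ENNReal.toReal_pos (Metric.measure_ball_pos _ _ one_pos).ne' measure_ball_lt_top.ne)
  refine ⟨min 1 (c₀ / (2 * K * J + 1)), by positivity, fun M hM η hη hηc p hp => ?_⟩
  have hM0 : 0 < M := by linarith
  have hMs : 0 < M ^ (-s) := by positivity
  have hη1 : η ≤ 1 := hηc.trans (mul_le_one₀ (min_le_left _ _) hMs.le
    (Real.rpow_le_one_of_one_le_of_nonpos hM (by linarith [hs.1])))
  have hη2 : η * (2 * K * J + 1) ≤ c₀ * M ^ (-s) := by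
    have h := hηc.trans (mul_le_mul_of_nonneg_right (min_le_right _ _) hMs.le)
    rwa [div_mul_eq_mul_div, le_div_iff₀ (by positivity)] at h
  have hφc : Continuous φ := hφ_smooth.continuous
  have hpgraph : lastCoord p = η * φ (projFirst p) :=
    frontier_lt_subset_eq continuous_lastCoord (by fun_prop) hp
  have hu1 : ∀ x, η * φ x ≤ 1 := fun x =>
    mul_le_one₀ hη1 (hφ_range x).1 (hφ_range x).2
  obtain ⟨hint, h, hh, hle⟩ := exists_hasNMC_le hn hs (u := fun x => η * φ x)
    (by fun_prop) (H := 4 * M) (fun x => (hu1 x).trans (by linarith)) hpgraph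
    (by linarith [hu1 (projFirst p)]) (η • fderiv ℝ φ (projFirst p)) (B := η * K)
    (by positivity) (fun z => by
      have h := mul_le_mul_of_nonneg_left (hK (projFirst p) z) hη.le
      rw [← abs_of_pos hη, ← abs_mul, abs_of_pos hη] at h
      simpa only [mul_sub, mul_assoc, smul_apply, smul_eq_mul] using h)
  refine ⟨h, hh, ?_⟩
  obtain ⟨x, hx, hball⟩ := exists_norm_eq_and_ball_subset_lt_lastCoord hn0 hM0
  have hmass := ball_mass_mul_rpow_le_setIntegral volume hs.1 hM0 hx
    (A := {z : EuclideanSpace ℝ (Fin n) | 4 * M < lastCoord (p + z)})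
    (fun z hz => by
      have h₁ : 4 * M < lastCoord z := hball hz
      have h₂ := mul_nonneg hη.le (hφ_range (projFirst p)).1
      change 4 * M < lastCoord (p + z)
      rw [lastCoord_add, hpgraph]
      linarith) (by simpa only [finrank_euclideanSpace_fin] using hint)
  simp only [finrank_euclideanSpace_fin] at hmass
  nlinarith
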